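/- There exist a constant c > 0 and N₀ ∈ ℕ such that for every integer N ≥ N₀, the high-pass filter of Riemann's non-differentiable function satisfies ‖R_{≥N}‖_{L⁴(𝕋)} ≥ c · N^{-3/4} · (log N)^{1/4}. -/

import Mathlib

open Real MeasureTheory

/-- `σ k = 1` if `k` is a perfect square, `0` otherwise. -/
noncomputable def sqIndicator (k : ℕ) : ℝ := if IsSquare k then 1 else 0

/-- The character `e_k(x) = e^{2πikx}`. -/
noncomputable def eChar (k : ℕ) (x : ℝ) : ℂ :=
  Complex.exp (2 * Real.pi * Complex.I * (k : ℂ) * (x : ℂ))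

/-- Riemann's non-differentiable function `R(x) = ∑_{k≥1} (σ_k/k) e^{2πikx}
    = ∑_{n≥1} e^{2πin²x}/n²`. -/
noncomputable def RiemannF (x : ℝ) : ℂ :=
  ∑' k : ℕ, ((sqIndicator k / k : ℝ) : ℂ) * eChar k x

/-- High-pass filter `R_{≥N}(x) = ∑_{k ≥ N} (σ_k/k) e^{2πikx}`. -/
noncomputable def RiemannHigh (N : ℕ) (x : ℝ) : ℂ :=
  ∑' k : ℕ, if N ≤ k then ((sqIndicator k / k : ℝ) : ℂ) * eChar k x else 0

/-- The frequencies cancel on the circle exactly when they are balanced. -/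
lemma integral_eChar_quadruple (a b c d : ℕ) :
    ∫ x in (0:ℝ)..1, eChar a x * eChar b x *
        (starRingEnd ℂ (eChar c x) * starRingEnd ℂ (eChar d x)) =
      if a + b = c + d then 1 else 0 := by
  have key : ∀ x : ℝ, eChar a x * eChar b x *
      (starRingEnd ℂ (eChar c x) * starRingEnd ℂ (eChar d x)) =
      Complex.exp ((2 * Real.pi * Complex.I * ((a + b - (c + d) : ℤ) : ℂ)) * x) := by
    intro x
    simp only [eChar, ← Complex.exp_conj, ← Complex.exp_add]
    congr 1
    simp only [map_mul, Complex.conj_ofReal, Complex.conj_I, map_ofNat, map_natCast]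
    push_cast
    ring
  simp only [key]
  split_ifs with h
  · have : (a + b - (c + d) : ℤ) = 0 := by omega
    simp [this]
  · have hn : (a + b - (c + d) : ℤ) ≠ 0 := by omega
    rw [integral_exp_mul_complex
      (mul_ne_zero Complex.two_pi_I_ne_zero (Int.cast_ne_zero.mpr hn))]
    have : (2 * Real.pi * Complex.I * ((a + b - (c + d) : ℤ) : ℂ)) =
      ((a + b - (c + d) : ℤ) : ℂ) * (2 * Real.pi * Complex.I) := by ring
    rw [this]
    simp [-Int.cast_sub, -Int.cast_add, Complex.exp_int_mul_two_pi_mul_I]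

lemma norm_eChar (k : ℕ) (x : ℝ) : ‖eChar k x‖ = 1 := by
  have : (2 * Real.pi * Complex.I * (k : ℂ) * (x : ℂ)) =
      ((2 * Real.pi * k * x : ℝ) : ℂ) * Complex.I := by push_cast; ring
  rw [eChar, this, Complex.norm_exp_ofReal_mul_I]

@[fun_prop]
lemma continuous_eChar (k : ℕ) : Continuous (eChar k) := by
  unfold eChar; fun_prop

lemma integral_norm_pow_four_sum (w : ℕ → ℝ) (s : Finset ℕ) :
    ∫ x in (0:ℝ)..1, ‖∑ k ∈ s, (w k : ℂ) * eChar k x‖ ^ 4 =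
      ∑ p ∈ (s ×ˢ s) ×ˢ (s ×ˢ s), if p.1.1 + p.1.2 = p.2.1 + p.2.2 then
        w p.1.1 * w p.1.2 * (w p.2.1 * w p.2.2) else 0 := by
  have key : ∀ x : ℝ, ((‖∑ k ∈ s, (w k : ℂ) * eChar k x‖ ^ 4 : ℝ) : ℂ) =
      ∑ p ∈ (s ×ˢ s) ×ˢ (s ×ˢ s),
        ((w p.1.1 * w p.1.2 * (w p.2.1 * w p.2.2) : ℝ) : ℂ) *
        (eChar p.1.1 x * eChar p.1.2 x *
          (starRingEnd ℂ (eChar p.2.1 x) * starRingEnd ℂ (eChar p.2.2 x))) := by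
    intro x
    set z := ∑ k ∈ s, (w k : ℂ) * eChar k x with hz
    have h1 : ((‖z‖ ^ 4 : ℝ) : ℂ) = (z * z) * (starRingEnd ℂ z * starRingEnd ℂ z) := by
      have := Complex.mul_conj' z
      push_cast
      linear_combination -(z * starRingEnd ℂ z + (‖z‖ : ℂ) ^ 2) * this
    rw [h1, hz, map_sum, Finset.sum_mul_sum, Finset.sum_mul_sum, ← Finset.sum_product',
      ← Finset.sum_product', Finset.sum_mul_sum, ← Finset.sum_product']
    refine Finset.sum_congr rfl fun p _ => ?_
    simp only [map_mul, Complex.conj_ofReal]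
    push_cast
    ring
  apply Complex.ofReal_injective
  rw [← intervalIntegral.integral_ofReal]
  simp only [key]
  rw [intervalIntegral.integral_finsetSum]
  · push_cast
    refine Finset.sum_congr rfl fun p _ => ?_
    rw [intervalIntegral.integral_const_mul, integral_eChar_quadruple]
    split_ifs <;> simp
  · intro p _
    apply Continuous.intervalIntegrable
    fun_prop

/-- For nonnegative coefficients, any finite family of additive quadruples bounds the fourth
moment from below. -/
lemma card_mul_pow_le_integral (w : ℕ → ℝ) (hw : ∀ k, 0 ≤ w k) (hs : Summable w)
    (Q : Finset ((ℕ × ℕ) × (ℕ × ℕ))) (δ : ℝ) (hδ : 0 ≤ δ)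
    (hQ : ∀ p ∈ Q, p.1.1 + p.1.2 = p.2.1 + p.2.2 ∧
      δ ≤ w p.1.1 ∧ δ ≤ w p.1.2 ∧ δ ≤ w p.2.1 ∧ δ ≤ w p.2.2) :
    Q.card * δ ^ 4 ≤ ∫ x in (0:ℝ)..1, ‖∑' k, (w k : ℂ) * eChar k x‖ ^ 4 := by
  have hnorm : ∀ k x, ‖(w k : ℂ) * eChar k x‖ = w k := fun k x => by
    rw [norm_mul, norm_eChar, mul_one, Complex.norm_real, Real.norm_of_nonneg (hw k)]
  have hsum : ∀ x, Summable fun k => (w k : ℂ) * eChar k x := fun x =>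
    Summable.of_norm (by simpa only [hnorm] using hs)
  have hlim : Filter.Tendsto
      (fun s : Finset ℕ => ∫ x in (0:ℝ)..1, ‖∑ k ∈ s, (w k : ℂ) * eChar k x‖ ^ 4)
      Filter.atTop (nhds (∫ x in (0:ℝ)..1, ‖∑' k, (w k : ℂ) * eChar k x‖ ^ 4)) := by
    apply intervalIntegral.tendsto_integral_filter_of_dominated_convergence
      (fun _ => (∑' k, w k) ^ 4)
    · refine Filter.Eventually.of_forall fun s => Continuous.aestronglyMeasurable ?_
      fun_prop
    · refine Filter.Eventually.of_forall fun s => Filter.Eventually.of_forall fun x _ => ?_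
      rw [norm_pow, norm_norm]
      gcongr
      calc ‖∑ k ∈ s, (w k : ℂ) * eChar k x‖ ≤ ∑ k ∈ s, ‖(w k : ℂ) * eChar k x‖ :=
            norm_sum_le _ _
        _ = ∑ k ∈ s, w k := by simp only [hnorm]
        _ ≤ ∑' k, w k := hs.sum_le_tsum s fun k _ => hw k
    · exact intervalIntegrable_const
    · exact Filter.Eventually.of_forall fun x _ => ((hsum x).hasSum.norm).pow 4
  refine ge_of_tendsto hlim ?_
  let s₀ : Finset ℕ := Q.image (·.1.1) ∪ Q.image (·.1.2) ∪ (Q.image (·.2.1) ∪ Q.image (·.2.2))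
  filter_upwards [Filter.eventually_ge_atTop s₀] with s hss
  rw [integral_norm_pow_four_sum]
  have hsub : Q ⊆ (s ×ˢ s) ×ˢ (s ×ˢ s) := by
    intro p hp
    simp only [Finset.mem_product]
    refine ⟨⟨hss ?_, hss ?_⟩, hss ?_, hss ?_⟩ <;>
      simp only [s₀, Finset.mem_union, Finset.mem_image]
    · exact .inl (.inl ⟨p, hp, rfl⟩)
    · exact .inl (.inr ⟨p, hp, rfl⟩)
    · exact .inr (.inl ⟨p, hp, rfl⟩)
    · exact .inr (.inr ⟨p, hp, rfl⟩)
  refine le_trans ?_ (Finset.sum_le_sum_of_subset_of_nonneg hsub fun p _ _ => ?_)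
  · rw [← nsmul_eq_mul]
    refine Finset.card_nsmul_le_sum _ _ _ fun p hp => ?_
    obtain ⟨h, h1, h2, h3, h4⟩ := hQ p hp
    rw [if_pos h]
    have := hw p.1.1
    have := hw p.1.2
    have := hw p.2.1
    calc δ ^ 4 = δ * δ * (δ * δ) := by ring
      _ ≤ _ := by gcongr
  · have := hw p.1.1
    have := hw p.1.2
    have := hw p.2.1
    have := hw p.2.2
    split_ifs <;> positivity

lemma sum_Icc_inv_sq_add_inv_le_two (n : ℕ) :
    ∑ f ∈ Finset.Icc 1 n, ((f : ℝ) ^ 2)⁻¹ + (n : ℝ)⁻¹ ≤ 2 := by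
  induction n with
  | zero => simp
  | succ n ih =>
    rw [Finset.sum_Icc_succ_top (by omega)]
    rcases Nat.eq_zero_or_pos n with rfl | hn
    · norm_num
    · have hn' : (0:ℝ) < n := by exact_mod_cast hn
      have : (((n + 1 : ℕ) : ℝ) ^ 2)⁻¹ + ((n + 1 : ℕ) : ℝ)⁻¹ ≤ (n : ℝ)⁻¹ := by
        push_cast
        rw [← sub_nonneg]
        have : (n : ℝ)⁻¹ - (((n + 1 : ℝ) ^ 2)⁻¹ + ((n + 1 : ℝ))⁻¹) =
            1 / (n * (n + 1) ^ 2) := by field_simp; ring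
        rw [this]
        positivity
      linarith

/-- Dirichlet convolution of `φ(e)/e²` and `1/f²` is `1/d`. -/
lemma sum_inv_le_two_mul_sum_totient_div_sq (K : ℕ) :
    ∑ d ∈ Finset.Icc 1 K, (d : ℝ)⁻¹ ≤
      2 * ∑ e ∈ Finset.Icc 1 K, (Nat.totient e : ℝ) / (e : ℝ) ^ 2 := by
  have hconv : ∑ d ∈ Finset.Icc 1 K, (d : ℝ)⁻¹ ≤
      (∑ e ∈ Finset.Icc 1 K, (Nat.totient e : ℝ) / (e : ℝ) ^ 2) *
        ∑ f ∈ Finset.Icc 1 K, ((f : ℝ) ^ 2)⁻¹ := by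
    rw [Finset.sum_mul_sum, ← Finset.sum_product']
    refine le_trans (le_of_eq ?_) (Finset.sum_fiberwise_le_sum_of_sum_fiber_nonneg
      (t := Finset.Icc 1 K) (g := fun p : ℕ × ℕ => p.1 * p.2)
      fun d _ => Finset.sum_nonneg fun p _ => by positivity)
    refine Finset.sum_congr rfl fun d hd => ?_
    obtain ⟨hd1, hdK⟩ := Finset.mem_Icc.mp hd
    have hfil : {p ∈ Finset.Icc 1 K ×ˢ Finset.Icc 1 K | p.1 * p.2 = d} =
        d.divisorsAntidiagonal := by
      ext ⟨e, f⟩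
      simp only [Finset.mem_filter, Finset.mem_product, Finset.mem_Icc,
        Nat.mem_divisorsAntidiagonal]
      constructor
      · rintro ⟨_, h⟩
        exact ⟨h, by omega⟩
      · rintro ⟨h, _⟩
        have he : 0 < e := Nat.pos_of_ne_zero (by rintro rfl; omega)
        have hf : 0 < f := Nat.pos_of_ne_zero (by rintro rfl; omega)
        exact ⟨⟨⟨he, by nlinarith⟩, hf, by nlinarith⟩, h⟩
    have hterm : ∀ p ∈ d.divisorsAntidiagonal,
        (Nat.totient p.1 : ℝ) / (p.1 : ℝ) ^ 2 * ((p.2 : ℝ) ^ 2)⁻¹ =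
          (Nat.totient p.1 : ℝ) * ((d : ℝ) ^ 2)⁻¹ := by
      intro p hp
      rw [← (Nat.mem_divisorsAntidiagonal.mp hp).1]
      push_cast
      rw [mul_pow, mul_inv, div_eq_mul_inv, mul_assoc]
    rw [hfil, Finset.sum_congr rfl hterm, ← Finset.sum_mul,
      Nat.sum_divisorsAntidiagonal (f := fun e _ => (Nat.totient e : ℝ)), ← Nat.cast_sum,
      Nat.sum_totient]
    have : (d : ℝ) ≠ 0 := by positivity
    field_simp
  have h2 : ∑ f ∈ Finset.Icc 1 K, ((f : ℝ) ^ 2)⁻¹ ≤ 2 := by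
    have := sum_Icc_inv_sq_add_inv_le_two K
    have : (0:ℝ) ≤ (K : ℝ)⁻¹ := by positivity
    linarith
  calc _ ≤ _ := hconv
    _ ≤ (∑ e ∈ Finset.Icc 1 K, (Nat.totient e : ℝ) / (e : ℝ) ^ 2) * 2 := by
      gcongr
    _ = _ := mul_comm _ _

/-- Parameters `(q, r, p, s)` with `q, r` coprime describing solutions of
`a² + b² = c² + d²` of size comparable to `M`. -/
def quadrupleParams (M : ℕ) : Finset (Σ _ : ℕ, ℕ × ℕ × ℕ) :=
  (Finset.Icc 1 (M / 2)).sigma fun q =>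
    {r ∈ Finset.Ico q (q + q) | q.Coprime r} ×ˢ
      (Finset.Icc 1 (M / (2 * q)) ×ˢ
        Finset.Ico (8 * (M / (2 * q))) (9 * (M / (2 * q))))

/-- The squares of the solution `(rs + pq, qs - pr; rs - pq, pr + qs)` of
`a² + b² = c² + d²`. -/
def quadrupleOfParams (t : Σ _ : ℕ, ℕ × ℕ × ℕ) : (ℕ × ℕ) × (ℕ × ℕ) :=
  (((t.2.1 * t.2.2.2 + t.2.2.1 * t.1) ^ 2, (t.1 * t.2.2.2 - t.2.2.1 * t.2.1) ^ 2),
   ((t.2.1 * t.2.2.2 - t.2.2.1 * t.1) ^ 2, (t.2.2.1 * t.2.1 + t.1 * t.2.2.2) ^ 2))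

lemma bounds_of_mem_quadrupleParams {M q r p s : ℕ}
    (h : (⟨q, r, p, s⟩ : Σ _ : ℕ, ℕ × ℕ × ℕ) ∈ quadrupleParams M) :
    0 < q ∧ q.Coprime r ∧ 0 < p ∧ p * q + M ≤ r * s ∧ p * r + M ≤ q * s ∧
      r * s + p * q ≤ 10 * M ∧ p * r + q * s ≤ 10 * M := by
  simp only [quadrupleParams, Finset.mem_sigma, Finset.mem_product, Finset.mem_filter,
    Finset.mem_Icc, Finset.mem_Ico] at h
  obtain ⟨⟨hq, hqM⟩, ⟨⟨hqr, hrq⟩, hco⟩, ⟨hp, hpT⟩, hsT, hTs⟩ := h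
  set T := M / (2 * q) with hT
  have h1 : 2 * q * T ≤ M := Nat.mul_div_le M (2 * q)
  have h2 : M < 2 * q * (T + 1) := Nat.lt_mul_div_succ M (by omega)
  have hT1 : 1 ≤ T := hp.trans hpT
  have hqT : q ≤ q * T := Nat.le_mul_of_pos_right q hT1
  have hpq : p * q ≤ T * q := Nat.mul_le_mul_right q hpT
  have hpr : p * r ≤ T * (2 * q) := Nat.mul_le_mul hpT (by omega)
  have hqs : q * (8 * T) ≤ q * s := Nat.mul_le_mul_left q hsT
  have hqs' : q * s ≤ q * (9 * T) := Nat.mul_le_mul_left q hTs.le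
  have hrs : q * s ≤ r * s := Nat.mul_le_mul_right s hqr
  have hrs' : r * s ≤ (2 * q) * (9 * T) := Nat.mul_le_mul (by omega) hTs.le
  refine ⟨hq, hco, hp, ?_, ?_, ?_, ?_⟩ <;> nlinarith

lemma quadrupleOfParams_injOn (M : ℕ) :
    Set.InjOn quadrupleOfParams (quadrupleParams M) := by
  rintro ⟨q, r, p, s⟩ h ⟨q', r', p', s'⟩ h' heq
  obtain ⟨hq, hco, hp, h1, h2, -, -⟩ := bounds_of_mem_quadrupleParams h
  obtain ⟨hq', hco', hp', h1', h2', -, -⟩ := bounds_of_mem_quadrupleParams h'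
  simp only [quadrupleOfParams, Prod.mk.injEq, Nat.pow_left_inj (two_ne_zero)] at heq
  obtain ⟨⟨ha, hb⟩, hc, hd⟩ := heq
  have hpq : p * q = p' * q' := by omega
  have hpr : p * r = p' * r' := by omega
  have hqs : q * s = q' * s' := by omega
  have hpp : p = p' := by
    have e1 : Nat.gcd (p * q) (p * r) = p := by rw [Nat.gcd_mul_left, hco, mul_one]
    have e2 : Nat.gcd (p' * q') (p' * r') = p' := by rw [Nat.gcd_mul_left, hco', mul_one]
    rw [← e1, hpq, hpr, e2]
  subst hpp
  obtain rfl := Nat.eq_of_mul_eq_mul_left hp hpq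
  obtain rfl := Nat.eq_of_mul_eq_mul_left hp hpr
  obtain rfl := Nat.eq_of_mul_eq_mul_left hq hqs
  rfl

lemma quadrupleOfParams_balanced {q r p s : ℕ} (h1 : p * q ≤ r * s) (h2 : p * r ≤ q * s) :
    (r * s + p * q) ^ 2 + (q * s - p * r) ^ 2 =
      (r * s - p * q) ^ 2 + (p * r + q * s) ^ 2 := by
  zify [h1, h2]
  ring

lemma card_quadrupleParams_ge (M : ℕ) :
    (M : ℝ) ^ 2 / 32 * ∑ d ∈ Finset.Icc 1 (M / 2), (d : ℝ)⁻¹ ≤ (quadrupleParams M).card := by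
  have hcard : (quadrupleParams M).card =
      ∑ q ∈ Finset.Icc 1 (M / 2), Nat.totient q * (M / (2 * q)) ^ 2 := by
    rw [quadrupleParams, Finset.card_sigma]
    refine Finset.sum_congr rfl fun q _ => ?_
    rw [Finset.card_product, Finset.card_product, Nat.filter_coprime_Ico_eq_totient,
      Nat.card_Icc, Nat.card_Ico, sq]
    congr 2
    omega
  have hq : ∀ q ∈ Finset.Icc 1 (M / 2), (M : ℝ) ^ 2 / 16 *
      ((Nat.totient q : ℝ) / (q : ℝ) ^ 2) ≤ ((Nat.totient q * (M / (2 * q)) ^ 2 : ℕ) : ℝ) := by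
    intro q hq
    obtain ⟨hq1, hqM⟩ := Finset.mem_Icc.mp hq
    have hq0 : (0:ℝ) < q := by exact_mod_cast hq1
    have hT1 : 1 ≤ M / (2 * q) := (Nat.one_le_div_iff (by omega)).mpr (by omega)
    have h2 : M < 2 * q * (M / (2 * q) + 1) := Nat.lt_mul_div_succ M (by omega)
    have h3 : M ≤ 4 * q * (M / (2 * q)) := by nlinarith
    have h4 : (M : ℝ) / (4 * q) ≤ ((M / (2 * q) : ℕ) : ℝ) := by
      rw [div_le_iff₀ (by positivity), mul_comm]
      exact_mod_cast h3
    calc (M : ℝ) ^ 2 / 16 * ((Nat.totient q : ℝ) / (q : ℝ) ^ 2)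
        = Nat.totient q * ((M : ℝ) / (4 * q)) ^ 2 := by field_simp; ring
      _ ≤ Nat.totient q * ((M / (2 * q) : ℕ) : ℝ) ^ 2 := by gcongr
      _ = _ := by push_cast; rfl
  calc (M : ℝ) ^ 2 / 32 * ∑ d ∈ Finset.Icc 1 (M / 2), (d : ℝ)⁻¹
      ≤ (M : ℝ) ^ 2 / 32 *
        (2 * ∑ e ∈ Finset.Icc 1 (M / 2), (Nat.totient e : ℝ) / (e : ℝ) ^ 2) := by
        gcongr
        exact sum_inv_le_two_mul_sum_totient_div_sq _
    _ = ∑ q ∈ Finset.Icc 1 (M / 2),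
        (M : ℝ) ^ 2 / 16 * ((Nat.totient q : ℝ) / (q : ℝ) ^ 2) := by
        rw [← Finset.mul_sum]; ring
    _ ≤ ∑ q ∈ Finset.Icc 1 (M / 2), ((Nat.totient q * (M / (2 * q)) ^ 2 : ℕ) : ℝ) :=
        Finset.sum_le_sum hq
    _ = _ := by rw [hcard]; push_cast; rfl

lemma summable_sqIndicator_div : Summable fun k : ℕ => sqIndicator k / k := by
  have hinj : Function.Injective fun n : ℕ => n ^ 2 := Nat.pow_left_injective two_ne_zero
  rw [← hinj.summable_iff]
  · have : ((fun k : ℕ => sqIndicator k / k) ∘ fun n : ℕ => n ^ 2) =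
        fun n : ℕ => 1 / (n : ℝ) ^ 2 := by
      ext n
      simp [sqIndicator, IsSquare.sq n]
    rw [this]
    exact Real.summable_one_div_nat_pow.mpr one_lt_two
  · intro k hk
    have : ¬ IsSquare k := by
      rintro ⟨m, rfl⟩
      exact hk ⟨m, sq m⟩
    simp [sqIndicator, this]

/-- The coefficients of `RiemannHigh N`. -/
noncomputable def highCoeff (N k : ℕ) : ℝ := if N ≤ k then sqIndicator k / k else 0

lemma sqIndicator_div_nonneg (k : ℕ) : 0 ≤ sqIndicator k / k := by
  unfold sqIndicator
  split_ifs <;> positivity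

lemma highCoeff_nonneg (N k : ℕ) : 0 ≤ highCoeff N k := by
  unfold highCoeff
  split_ifs
  · exact sqIndicator_div_nonneg k
  · exact le_rfl

lemma summable_highCoeff (N : ℕ) : Summable (highCoeff N) := by
  refine summable_sqIndicator_div.of_nonneg_of_le (highCoeff_nonneg N) fun k => ?_
  unfold highCoeff
  split_ifs
  · exact le_rfl
  · exact sqIndicator_div_nonneg k

lemma RiemannHigh_eq_tsum (N : ℕ) (x : ℝ) :
    RiemannHigh N x = ∑' k, (highCoeff N k : ℂ) * eChar k x := by
  unfold RiemannHigh highCoeff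
  congr 1
  ext k
  split_ifs <;> simp

lemma le_highCoeff_sq {N M a : ℕ} (hM : 0 < M) (hN : N ≤ M ^ 2) (h1 : M ≤ a)
    (h2 : a ≤ 10 * M) : 1 / (100 * (M : ℝ) ^ 2) ≤ highCoeff N (a ^ 2) := by
  have hNa : N ≤ a ^ 2 := hN.trans (Nat.pow_le_pow_left h1 2)
  have ha : (0:ℝ) < a := by exact_mod_cast hM.trans_le h1
  have h2' : (a : ℝ) ≤ 10 * M := by exact_mod_cast h2
  rw [highCoeff, if_pos hNa, sqIndicator, if_pos (IsSquare.sq a)]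
  push_cast
  apply one_div_le_one_div_of_le (by positivity)
  nlinarith

lemma integral_RiemannHigh_ge {N M : ℕ} (hM : 0 < M) (hN : N ≤ M ^ 2) :
    (M : ℝ) ^ 2 / 32 * (∑ d ∈ Finset.Icc 1 (M / 2), (d : ℝ)⁻¹) *
      (1 / (100 * (M : ℝ) ^ 2)) ^ 4 ≤ ∫ x in (0:ℝ)..1, ‖RiemannHigh N x‖ ^ 4 := by
  simp only [RiemannHigh_eq_tsum]
  refine le_trans ?_ (card_mul_pow_le_integral (highCoeff N) (highCoeff_nonneg N)
    (summable_highCoeff N) ((quadrupleParams M).image quadrupleOfParams)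
    (1 / (100 * (M : ℝ) ^ 2)) (by positivity) ?_)
  · rw [Finset.card_image_of_injOn (quadrupleOfParams_injOn M)]
    gcongr
    exact card_quadrupleParams_ge M
  · intro t ht
    obtain ⟨⟨q, r, p, s⟩, hu, rfl⟩ := Finset.mem_image.mp ht
    obtain ⟨-, -, -, h1, h2, h3, h4⟩ := bounds_of_mem_quadrupleParams hu
    dsimp only [quadrupleOfParams]
    refine ⟨quadrupleOfParams_balanced (by omega) (by omega), ?_, ?_, ?_, ?_⟩ <;>
      apply le_highCoeff_sq hM hN <;> omega

lemma quarter_log_le_sum_inv {N M : ℕ} (hN16 : 16 ≤ N) (hN : N ≤ M ^ 2) :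
    Real.log N / 4 ≤ ∑ d ∈ Finset.Icc 1 (M / 2), (d : ℝ)⁻¹ := by
  have hM4 : 4 ≤ M := by nlinarith
  have hM4' : (4:ℝ) ≤ M := by exact_mod_cast hM4
  have hharm : Real.log ((M / 2 + 1 : ℕ) : ℝ) ≤ ∑ d ∈ Finset.Icc 1 (M / 2), (d : ℝ)⁻¹ := by
    have := log_add_one_le_harmonic (M / 2)
    rw [harmonic_eq_sum_Icc] at this
    push_cast at this ⊢
    exact this
  refine le_trans ?_ hharm
  have h1 : (M : ℝ) / 2 ≤ ((M / 2 + 1 : ℕ) : ℝ) := by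
    have : M ≤ (M / 2 + 1) * 2 := by omega
    rw [div_le_iff₀ two_pos]
    exact_mod_cast this
  have hN0 : (0:ℝ) < N := by exact_mod_cast (by omega : 0 < N)
  have h2 : (N : ℝ) ≤ ((M / 2 + 1 : ℕ) : ℝ) ^ 4 := by
    have hNM : (N : ℝ) ≤ (M : ℝ) ^ 2 := by exact_mod_cast hN
    calc (N : ℝ) ≤ (M : ℝ) ^ 2 := hNM
      _ ≤ ((M : ℝ) / 2) ^ 4 := by
        have : (16:ℝ) ≤ (M : ℝ) ^ 2 := by nlinarith
        nlinarith
      _ ≤ _ := by gcongr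
  have h3 := Real.log_le_log hN0 h2
  rw [Real.log_pow] at h3
  push_cast at h3 ⊢
  linarith

lemma integral_RiemannHigh_ge_log {N : ℕ} (hN : 16 ≤ N) :
    1 / (8192 * 10 ^ 8) * ((N : ℝ) ^ 3)⁻¹ * Real.log N ≤
      ∫ x in (0:ℝ)..1, ‖RiemannHigh N x‖ ^ 4 := by
  set M := Nat.sqrt N + 1 with hM
  have hNM : N ≤ M ^ 2 := by
    have := Nat.lt_succ_sqrt N
    rw [sq]
    exact this.le
  have hMN : M ^ 2 ≤ 4 * N := by
    have h1 := Nat.sqrt_le N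
    have h2 : 1 ≤ Nat.sqrt N := Nat.sqrt_pos.mpr (by omega)
    nlinarith
  have hM0 : (0:ℝ) < M := by positivity
  have hN0 : (0:ℝ) < N := by exact_mod_cast (by omega : 0 < N)
  have hlog : 0 ≤ Real.log N := Real.log_natCast_nonneg N
  refine le_trans ?_ (integral_RiemannHigh_ge (N := N) (by omega) hNM)
  have hMN' : (M : ℝ) ^ 2 ≤ 4 * N := by exact_mod_cast hMN
  calc 1 / (8192 * 10 ^ 8) * ((N : ℝ) ^ 3)⁻¹ * Real.log N
      = 1 / (32 * 10 ^ 8) * ((4 * (N : ℝ)) ^ 3)⁻¹ * (Real.log N / 4) := by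
        rw [mul_pow, mul_inv]; ring
    _ ≤ 1 / (32 * 10 ^ 8) * (((M : ℝ) ^ 2) ^ 3)⁻¹ *
        ∑ d ∈ Finset.Icc 1 (M / 2), (d : ℝ)⁻¹ := by
        gcongr
        exact quarter_log_le_sum_inv hN hNM
    _ = _ := by
        field_simp
        ring

/-- There exist `c > 0` and `N₀ ∈ ℕ` such that for every integer `N ≥ N₀`,
`‖R_{≥N}‖_{L⁴(𝕋)} ≥ c · N^{-3/4} · (log N)^{1/4}`. -/
theorem riemann_highpass_L4_lower :
    ∃ c : ℝ, 0 < c ∧ ∃ N₀ : ℕ, ∀ N : ℕ, N₀ ≤ N →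
      c * (N : ℝ) ^ (-(3 : ℝ)/4) * (Real.log N) ^ ((1:ℝ)/4) ≤
        (∫ x in (0:ℝ)..1, ‖RiemannHigh N x‖ ^ 4) ^ ((1:ℝ)/4) := by
  refine ⟨(1 / (8192 * 10 ^ 8) : ℝ) ^ ((1:ℝ)/4), by positivity, 16, fun N hN => ?_⟩
  have hlog : 0 ≤ Real.log N := Real.log_natCast_nonneg N
  have hpow : (N : ℝ) ^ (-(3 : ℝ)/4) = (((N : ℝ) ^ 3)⁻¹) ^ ((1:ℝ)/4) := by
    rw [← Real.rpow_natCast, ← Real.rpow_neg (Nat.cast_nonneg N),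
      ← Real.rpow_mul (Nat.cast_nonneg N)]
    norm_num
  rw [hpow, ← Real.mul_rpow (by positivity) (by positivity),
    ← Real.mul_rpow (by positivity) hlog]
  exact Real.rpow_le_rpow (by positivity) (integral_RiemannHigh_ge_log hN) (by norm_num)
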